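/- Let μ be a Borel probability measure on [0,1]^d and c a distance-like function on [0,1]^d with c(·,0) ∈ L¹(μ). Fix data y and let Φ(·;y): [0,1]^d → ℝ and Φ^N(·;y): [0,1]^d → ℝ be measurable with 0 ≤ Φ(u;y) ≤ −log h(u,y) for a positive function h(·,y) with ∫ h(u,y) dμ(u) > 0, and set δ := sup_{u∈[0,1]^d} |Φ(u;y) − Φ^N(u;y)| < ∞. Let ν and ν^N be the posteriors with densities dν/dμ(u) = exp(−Φ(u;y))/Z(y) and dν^N/dμ(u) = exp(−Φ^N(u;y))/Z^N(y), with Z(y), Z^N(y) the corresponding normalizing constants. Then D(ν, ν^N; c) ≤ 2 e^{4δ} ( ‖c(·,0)‖_{L¹(μ)} / ‖h(·,y)‖_{L¹(μ)}² ) · δ. In particular, if δ ≤ C exp(−κ M^{1/(d+1)}) for constants C, κ > 0 (as supplied by a ReLU deep neural network surrogate Φ^N of size M approximating a holomorphic likelihood potential), then D(ν, ν^N; c) ≤ C' ‖c(·,0)‖_{L¹(μ)} exp(−κ M^{1/(d+1)}) with C' = 2Ce^{4δ}/‖h(·,y)‖_{L¹(μ)}². -/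

import Mathlib

open MeasureTheory Real ENNReal

/-- The integral probability metric `D(η₁, η₂; c)`: supremum of `∫ψ dη₁ − ∫ψ dη₂` over
functions `ψ` vanishing at the origin that are Lipschitz-1 with respect to the
distance-like function `c`. -/
noncomputable def ipm {X : Type*} [MeasurableSpace X] [Zero X]
    (c : X → X → ℝ) (η₁ η₂ : Measure X) : ℝ :=
  sSup {r : ℝ | ∃ ψ : X → ℝ, ψ 0 = 0 ∧ (∀ u v, |ψ u - ψ v| ≤ c u v) ∧
    r = (∫ u, ψ u ∂η₁) - ∫ u, ψ u ∂η₂}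

/-- The optimal transport cost `W(η₁, η₂; c)`: infimum of `∫ c dπ` over couplings `π`
of `(η₁, η₂)`. -/
noncomputable def otCost {X : Type*} [MeasurableSpace X]
    (c : X → X → ℝ) (η₁ η₂ : Measure X) : ℝ≥0∞ :=
  ⨅ pl ∈ {pl : Measure (X × X) |
      pl.map Prod.fst = η₁ ∧ pl.map Prod.snd = η₂ ∧ IsProbabilityMeasure pl},
    ∫⁻ p, ENNReal.ofReal (c p.1 p.2) ∂pl

/-- `c : X × X → ℝ` is distance-like: nonnegative, symmetric, lower semicontinuous and
vanishing exactly on the diagonal. -/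
def DistanceLike {X : Type*} [TopologicalSpace X] (c : X → X → ℝ) : Prop :=
  (∀ u v, 0 ≤ c u v) ∧ (∀ u v, c u v = c v u) ∧
    LowerSemicontinuous (fun p : X × X => c p.1 p.2) ∧
    ∀ u v, c u v = 0 ↔ u = v

/-- The posterior measure with prior `μ` and likelihood potential `Φ`:
`dν/dμ (u) = exp (−Φ u) / Z` with `Z = ∫ exp (−Φ u) dμ(u)`. -/
noncomputable def post {X : Type*} [MeasurableSpace X]
    (μ : Measure X) (Φ : X → ℝ) : Measure X :=
  μ.withDensity fun u => ENNReal.ofReal (Real.exp (-Φ u) / ∫ v, Real.exp (-Φ v) ∂μ)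

/-- Assumption A on a likelihood potential `Φ : X × Y → ℝ` with functions `(f, g, h)`:
(i) `Φ(·; y)` is `μ`-measurable for every `y`; (ii) `f : X → (0,∞)` is lower
semicontinuous, `g : Y → (0,∞)` and `h : X × Y → (0,∞)` are locally bounded, and
`−log f(u) − log g(y) ≤ Φ(u; y) ≤ −log h(u, y)` for all `(u, y)`. -/
structure AssumptionA {X Y : Type*} [MeasurableSpace X] [TopologicalSpace X]
    [TopologicalSpace Y] (μ : Measure X) (Φ : X → Y → ℝ)
    (f : X → ℝ) (g : Y → ℝ) (h : X → Y → ℝ) : Prop where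
  measurable : ∀ y, AEMeasurable (fun u => Φ u y) μ
  f_pos : ∀ u, 0 < f u
  f_lsc : LowerSemicontinuous f
  g_pos : ∀ y, 0 < g y
  g_locBdd : ∀ y : Y, ∃ s ∈ nhds y, BddAbove (g '' s)
  h_pos : ∀ u y, 0 < h u y
  h_locBdd : ∀ p : X × Y, ∃ s ∈ nhds p, BddAbove ((fun q : X × Y => h q.1 q.2) '' s)
  lower_bound : ∀ u y, -Real.log (f u) - Real.log (g y) ≤ Φ u y
  upper_bound : ∀ u y, Φ u y ≤ -Real.log (h u y)

/-- Two numbers within a factor `exp a` of each other differ by at most `a * exp a * p`. -/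
lemma abs_sub_le_of_exp_ratio {a p s : ℝ} (ha : 0 ≤ a) (hp : 0 ≤ p)
    (hsp : s ≤ Real.exp a * p) (hps : p ≤ Real.exp a * s) :
    |p - s| ≤ a * Real.exp a * p := by
  have h₁ : 1 - a ≤ Real.exp (-a) := by linarith [Real.add_one_le_exp (-a)]
  have h₂ : Real.exp a * Real.exp (-a) = 1 := by rw [← Real.exp_add]; simp
  have h₃ : 1 ≤ Real.exp a := Real.one_le_exp ha
  have h₄ : Real.exp a - 1 ≤ a * Real.exp a := by
    nlinarith [mul_le_mul_of_nonneg_left h₁ (Real.exp_pos a).le]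
  have h₅ : Real.exp (-a) * p ≤ s := by
    have := mul_le_mul_of_nonneg_left hps (Real.exp_pos (-a)).le
    rwa [← mul_assoc, mul_comm (Real.exp (-a)) (Real.exp a), h₂, one_mul] at this
  rw [abs_le]
  constructor
  · nlinarith [mul_le_mul_of_nonneg_right h₄ hp]
  · have h₆ : a * p ≤ a * Real.exp a * p :=
      mul_le_mul_of_nonneg_right (le_mul_of_one_le_right ha h₃) hp
    nlinarith [mul_le_mul_of_nonneg_right h₁ hp]

/-- Integration against the posterior is weighted integration against the prior. -/
lemma integral_post {X : Type*} [MeasurableSpace X] (μ : Measure X) {Φ : X → ℝ}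
    (hΦ : Measurable Φ) (ψ : X → ℝ) :
    ∫ u, ψ u ∂(post μ Φ) =
      ∫ u, Real.exp (-Φ u) / (∫ v, Real.exp (-Φ v) ∂μ) * ψ u ∂μ := by
  have hZ : 0 ≤ ∫ v, Real.exp (-Φ v) ∂μ := integral_nonneg fun v => (Real.exp_pos _).le
  rw [post, integral_withDensity_eq_integral_toReal_smul (by fun_prop)
    (Filter.Eventually.of_forall fun u => ENNReal.ofReal_lt_top)]
  refine integral_congr_ae (Filter.Eventually.of_forall fun u => ?_)
  simp only [smul_eq_mul]
  rw [ENNReal.toReal_ofReal (div_nonneg (Real.exp_pos _).le hZ)]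

/-- Multiplication by a positive measurable weight reflects a.e. strong measurability. -/
lemma aestronglyMeasurable_of_pos_mul {X : Type*} [MeasurableSpace X] {μ : Measure X}
    {w ψ : X → ℝ} (hw : Measurable w) (hw_pos : ∀ u, 0 < w u)
    (h : AEStronglyMeasurable (fun u => w u * ψ u) μ) : AEStronglyMeasurable ψ μ := by
  have := hw.inv.aestronglyMeasurable.mul h
  refine this.congr (Filter.Eventually.of_forall fun u => ?_)
  simp [inv_mul_cancel_left₀ (hw_pos u).ne']

/-- Weighted integrals of a function dominated by an integrable `g` differ by at most the
uniform distance of the weights times `∫ g`; no measurability of the function is needed. -/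
lemma integral_mul_sub_integral_mul_le {X : Type*} [MeasurableSpace X] {μ : Measure X}
    {p q ψ g : X → ℝ} {K B : ℝ} (hp : Measurable p) (hq : Measurable q)
    (hp_pos : ∀ u, 0 < p u) (hq_pos : ∀ u, 0 < q u) (hp_le : ∀ᵐ u ∂μ, p u ≤ B)
    (hpq : ∀ᵐ u ∂μ, |p u - q u| ≤ K) (hK : 0 ≤ K)
    (hg : Integrable g μ) (hψ : ∀ u, |ψ u| ≤ g u) :
    (∫ u, p u * ψ u ∂μ) - ∫ u, q u * ψ u ∂μ ≤ K * ∫ u, g u ∂μ := by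
  have hg_nonneg : ∀ u, 0 ≤ g u := fun u => (abs_nonneg _).trans (hψ u)
  by_cases hm : AEStronglyMeasurable ψ μ
  · have hψ_int : Integrable ψ μ := hg.mono' hm (Filter.Eventually.of_forall hψ)
    have hp_int : Integrable (fun u => p u * ψ u) μ :=
      hψ_int.bdd_mul (c := B) hp.aestronglyMeasurable (by
        filter_upwards [hp_le] with u hu
        rwa [Real.norm_of_nonneg (hp_pos u).le])
    have hq_int : Integrable (fun u => q u * ψ u) μ :=
      hψ_int.bdd_mul (c := B + K) hq.aestronglyMeasurable (by
        filter_upwards [hp_le, hpq] with u hu hu'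
        rw [Real.norm_of_nonneg (hq_pos u).le]
        linarith [(abs_le.1 hu').1])
    rw [← integral_sub hp_int hq_int, ← integral_const_mul]
    refine integral_mono_ae (hp_int.sub hq_int) (hg.const_mul K) ?_
    filter_upwards [hpq] with u hu
    calc p u * ψ u - q u * ψ u ≤ |(p u - q u) * ψ u| := by rw [← sub_mul]; exact le_abs_self _
      _ = |p u - q u| * |ψ u| := abs_mul _ _
      _ ≤ K * g u := mul_le_mul hu (hψ u) (abs_nonneg _) hK
  · have hp0 : ∫ u, p u * ψ u ∂μ = 0 :=
      integral_non_aestronglyMeasurable fun H =>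
        hm (aestronglyMeasurable_of_pos_mul hp hp_pos H)
    have hq0 : ∫ u, q u * ψ u ∂μ = 0 :=
      integral_non_aestronglyMeasurable fun H =>
        hm (aestronglyMeasurable_of_pos_mul hq hq_pos H)
    rw [hp0, hq0, sub_zero]
    exact mul_nonneg hK (integral_nonneg hg_nonneg)

/-- Stability of the posterior in the integral probability metric under a bounded
perturbation of a nonnegative potential. -/
lemma ipm_post_le {X : Type*} [MeasurableSpace X] [Zero X] (μ : Measure X)
    [IsProbabilityMeasure μ] {c : X → X → ℝ} (hc : ∀ u v, 0 ≤ c u v)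
    (hc_int : Integrable (fun u => c u 0) μ) {Φ Φ' : X → ℝ}
    (hΦ : Measurable Φ) (hΦ' : Measurable Φ') (hΦ_nonneg : ∀ u, 0 ≤ Φ u)
    {δ : ℝ} (hδ : 0 ≤ δ) (hdiff : ∀ᵐ u ∂μ, |Φ u - Φ' u| ≤ δ) :
    ipm c (post μ Φ) (post μ Φ') ≤
      2 * δ * Real.exp (2 * δ) / (∫ u, Real.exp (-Φ u) ∂μ) * ∫ u, c u 0 ∂μ := by
  have hle₁ : ∀ᵐ u ∂μ, Real.exp (-Φ' u) ≤ Real.exp δ * Real.exp (-Φ u) := by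
    filter_upwards [hdiff] with u hu
    rw [← Real.exp_add, Real.exp_le_exp]
    linarith [(abs_le.1 hu).2]
  have hle₂ : ∀ᵐ u ∂μ, Real.exp (-Φ u) ≤ Real.exp δ * Real.exp (-Φ' u) := by
    filter_upwards [hdiff] with u hu
    rw [← Real.exp_add, Real.exp_le_exp]
    linarith [(abs_le.1 hu).1]
  have hexp_le : ∀ u, Real.exp (-Φ u) ≤ 1 := fun u =>
    Real.exp_le_one_iff.2 (neg_nonpos.2 (hΦ_nonneg u))
  have hexp_int : Integrable (fun u => Real.exp (-Φ u)) μ :=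
    (integrable_const (1 : ℝ)).mono' (by fun_prop) (Filter.Eventually.of_forall fun u => by
      rw [Real.norm_of_nonneg (Real.exp_pos _).le]; exact hexp_le u)
  have hexp_int' : Integrable (fun u => Real.exp (-Φ' u)) μ :=
    (hexp_int.const_mul (Real.exp δ)).mono' (by fun_prop) (by
      filter_upwards [hle₁] with u hu
      rwa [Real.norm_of_nonneg (Real.exp_pos _).le])
  have hZ : 0 < ∫ u, Real.exp (-Φ u) ∂μ := integral_exp_pos hexp_int
  have hZ' : 0 < ∫ u, Real.exp (-Φ' u) ∂μ := integral_exp_pos hexp_int'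
  have hZ₁ : ∫ u, Real.exp (-Φ' u) ∂μ ≤ Real.exp δ * ∫ u, Real.exp (-Φ u) ∂μ := by
    rw [← integral_const_mul]
    exact integral_mono_ae hexp_int' (hexp_int.const_mul _) hle₁
  have hZ₂ : ∫ u, Real.exp (-Φ u) ∂μ ≤ Real.exp δ * ∫ u, Real.exp (-Φ' u) ∂μ := by
    rw [← integral_const_mul]
    exact integral_mono_ae hexp_int (hexp_int'.const_mul _) hle₂
  set Z := ∫ u, Real.exp (-Φ u) ∂μ with hZ_def
  set Z' := ∫ u, Real.exp (-Φ' u) ∂μ with hZ'_def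
  have hquot : ∀ {x y z w : ℝ}, 0 < z → 0 < w → 0 ≤ x → x ≤ Real.exp δ * y →
      w ≤ Real.exp δ * z → x / z ≤ Real.exp (2 * δ) * (y / w) := by
    intro x y z w hz hw hx hxy hwz
    rw [two_mul, Real.exp_add, ← mul_div_assoc, div_le_div_iff₀ hz hw]
    calc x * w ≤ (Real.exp δ * y) * (Real.exp δ * z) :=
          mul_le_mul hxy hwz hw.le (hx.trans hxy)
      _ = Real.exp δ * Real.exp δ * y * z := by ring
  have hK : 0 ≤ 2 * δ * Real.exp (2 * δ) / Z := by positivity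
  have hdens : ∀ᵐ u ∂μ, |Real.exp (-Φ u) / Z - Real.exp (-Φ' u) / Z'| ≤
      2 * δ * Real.exp (2 * δ) / Z := by
    filter_upwards [hle₁, hle₂] with u hu₁ hu₂
    refine (abs_sub_le_of_exp_ratio (a := 2 * δ) (by positivity) (by positivity)
      (hquot hZ' hZ (Real.exp_pos _).le hu₁ hZ₂)
      (hquot hZ hZ' (Real.exp_pos _).le hu₂ hZ₁)).trans ?_
    rw [← mul_div_assoc]
    exact div_le_div_of_nonneg_right
      (mul_le_of_le_one_right (by positivity) (hexp_le u)) hZ.le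
  refine Real.sSup_le ?_ (mul_nonneg hK (integral_nonneg fun u => hc u 0))
  rintro r ⟨ψ, hψ0, hψ, rfl⟩
  rw [integral_post μ hΦ, integral_post μ hΦ', ← hZ_def, ← hZ'_def]
  refine integral_mul_sub_integral_mul_le (B := 1 / Z) (by fun_prop) (by fun_prop)
    (fun u => by positivity) (fun u => by positivity)
    (Filter.Eventually.of_forall fun u => ?_) hdens hK hc_int (fun u => ?_)
  · exact div_le_div_of_nonneg_right (hexp_le u) hZ.le
  · simpa [hψ0] using hψ u 0

/-- DNN surrogate models: if `0 ≤ Φ ≤ −log h` on `[0,1]^d` and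
`δ = sup_{u∈[0,1]^d} |Φ(u) − Φ^N(u)| < ∞`, then the posteriors `ν, ν^N` obtained from
`Φ` and the surrogate `Φ^N` satisfy
`D(ν,ν^N;c) ≤ 2 e^{4δ} ‖c(·,0)‖_{L¹(μ)} / ‖h(·,y)‖_{L¹(μ)}² · δ`; in particular, if
`δ ≤ C exp(−κ M^{1/(d+1)})` then
`D(ν,ν^N;c) ≤ C' ‖c(·,0)‖_{L¹(μ)} exp(−κ M^{1/(d+1)})` with
`C' = 2 C e^{4δ} / ‖h(·,y)‖_{L¹(μ)}²`. -/
theorem dnn_surrogate_posterior_bound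
    {d : ℕ} (μ : Measure (EuclideanSpace ℝ (Fin d))) [IsProbabilityMeasure μ]
    (hμ : μ {u | ∀ i, u i ∈ Set.Icc (0 : ℝ) 1} = 1)
    (c : EuclideanSpace ℝ (Fin d) → EuclideanSpace ℝ (Fin d) → ℝ)
    (hc : DistanceLike c) (hc_int : Integrable (fun u => c u 0) μ)
    (Φ ΦN : EuclideanSpace ℝ (Fin d) → ℝ)
    (hΦ_meas : Measurable Φ) (hΦN_meas : Measurable ΦN)
    (h : EuclideanSpace ℝ (Fin d) → ℝ) (hh_pos : ∀ u, 0 < h u)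
    (hΦ_nonneg : ∀ u, 0 ≤ Φ u) (hΦ_le : ∀ u, Φ u ≤ -Real.log (h u))
    (hh_int : 0 < ∫ u, h u ∂μ)
    (δ : ℝ)
    (hδ : δ = sSup ((fun u => |Φ u - ΦN u|) '' {u | ∀ i, u i ∈ Set.Icc (0 : ℝ) 1}))
    (hδ_fin : BddAbove ((fun u => |Φ u - ΦN u|) '' {u | ∀ i, u i ∈ Set.Icc (0 : ℝ) 1})) :
    ipm c (post μ Φ) (post μ ΦN) ≤
        2 * Real.exp (4 * δ) * (∫ u, c u 0 ∂μ) / (∫ u, h u ∂μ) ^ 2 * δ ∧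
      ∀ (C κ : ℝ) (M : ℕ), 0 < C → 0 < κ →
        δ ≤ C * Real.exp (-κ * (M : ℝ) ^ (1 / (d + 1) : ℝ)) →
        ipm c (post μ Φ) (post μ ΦN) ≤
          2 * C * Real.exp (4 * δ) / (∫ u, h u ∂μ) ^ 2 * (∫ u, c u 0 ∂μ) *
            Real.exp (-κ * (M : ℝ) ^ (1 / (d + 1) : ℝ)) := by
  have hcube : MeasurableSet {u : EuclideanSpace ℝ (Fin d) | ∀ i, u i ∈ Set.Icc (0 : ℝ) 1} := by
    rw [Set.ofPred_forall]
    exact MeasurableSet.iInter fun i =>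
      measurableSet_Icc.preimage (by fun_prop : Measurable fun u : EuclideanSpace ℝ (Fin d) => u i)
  have hδ_nonneg : 0 ≤ δ := by
    rw [hδ]
    refine Real.sSup_nonneg ?_
    rintro _ ⟨u, -, rfl⟩
    exact abs_nonneg _
  have hdiff : ∀ᵐ u ∂μ, |Φ u - ΦN u| ≤ δ := by
    filter_upwards [(mem_ae_iff_prob_eq_one hcube).2 hμ] with u hu
    rw [hδ]
    exact le_csSup hδ_fin ⟨u, hu, rfl⟩
  have hexp_le : ∀ u, Real.exp (-Φ u) ≤ 1 := fun u =>
    Real.exp_le_one_iff.2 (neg_nonpos.2 (hΦ_nonneg u))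
  have hh_le : ∀ u, h u ≤ Real.exp (-Φ u) := fun u =>
    (Real.log_le_iff_le_exp (hh_pos u)).1 (le_neg_of_le_neg (hΦ_le u))
  have hh_integrable : Integrable h μ := by
    by_contra H
    exact hh_int.ne' (integral_undef H)
  have hexp_int : Integrable (fun u => Real.exp (-Φ u)) μ :=
    (integrable_const (1 : ℝ)).mono' (by fun_prop) (Filter.Eventually.of_forall fun u => by
      rw [Real.norm_of_nonneg (Real.exp_pos _).le]; exact hexp_le u)
  have hHZ : ∫ u, h u ∂μ ≤ ∫ u, Real.exp (-Φ u) ∂μ := integral_mono hh_integrable hexp_int hh_le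
  have hZ_le : ∫ u, Real.exp (-Φ u) ∂μ ≤ 1 := by
    simpa using integral_mono hexp_int (integrable_const (1 : ℝ)) hexp_le
  have hHsq : (∫ u, h u ∂μ) ^ 2 ≤ ∫ u, Real.exp (-Φ u) ∂μ :=
    (pow_le_of_le_one hh_int.le (hHZ.trans hZ_le) two_ne_zero).trans hHZ
  have hc_nonneg : 0 ≤ ∫ u, c u 0 ∂μ := integral_nonneg fun u => hc.1 u 0
  have hmain : ipm c (post μ Φ) (post μ ΦN) ≤
      2 * Real.exp (4 * δ) * (∫ u, c u 0 ∂μ) / (∫ u, h u ∂μ) ^ 2 * δ := by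
    calc ipm c (post μ Φ) (post μ ΦN)
        ≤ 2 * δ * Real.exp (2 * δ) / (∫ u, Real.exp (-Φ u) ∂μ) * ∫ u, c u 0 ∂μ :=
          ipm_post_le μ hc.1 hc_int hΦ_meas hΦN_meas hΦ_nonneg hδ_nonneg hdiff
      _ ≤ 2 * δ * Real.exp (4 * δ) / (∫ u, h u ∂μ) ^ 2 * ∫ u, c u 0 ∂μ := by
          gcongr
          norm_num
      _ = 2 * Real.exp (4 * δ) * (∫ u, c u 0 ∂μ) / (∫ u, h u ∂μ) ^ 2 * δ := by ring
  refine ⟨hmain, fun C κ M _ _ hδ_le => hmain.trans ?_⟩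
  calc 2 * Real.exp (4 * δ) * (∫ u, c u 0 ∂μ) / (∫ u, h u ∂μ) ^ 2 * δ
      ≤ 2 * Real.exp (4 * δ) * (∫ u, c u 0 ∂μ) / (∫ u, h u ∂μ) ^ 2 *
          (C * Real.exp (-κ * (M : ℝ) ^ (1 / (d + 1) : ℝ))) :=
        mul_le_mul_of_nonneg_left hδ_le (by positivity)
    _ = 2 * C * Real.exp (4 * δ) / (∫ u, h u ∂μ) ^ 2 * (∫ u, c u 0 ∂μ) *
          Real.exp (-κ * (M : ℝ) ^ (1 / (d + 1) : ℝ)) := by ring
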